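/- Let S be a set of pairwise commuting 2n × 2n symplectic involutions over Z_2 (so C^T P C = P, C² = I for every C ∈ S, and C C' = C' C for all C, C' ∈ S). Then there exists a single 2n × 2n symplectic matrix M over Z_2 such that for every C ∈ S, the matrix M C M⁻¹ has the block form [[A, E],[0, A^T]] for some n × n matrices A and E (depending on C); in particular the lower-left n × n block of M C M⁻¹ is zero. -/

import Mathlib

open Matrix

/-- The matrix `P = [[0, I_n],[I_n, 0]]` over `Z_2`, in `2n × 2n` block form. -/
def Pm (n : ℕ) : Matrix (Fin n ⊕ Fin n) (Fin n ⊕ Fin n) (ZMod 2) :=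
  Matrix.fromBlocks 0 1 1 0

section helpers

variable {V : Type*} [AddCommGroup V] [Module (ZMod 2) V]

lemma zmodTwo_add_self (x : V) : x + x = 0 := by
  rw [← two_smul (ZMod 2) x, show (2 : ZMod 2) = 0 from rfl, zero_smul]

/-- A vector of `W \ L` fixed modulo `L` by finitely many commuting involutions. -/
lemma exists_fixed_mod (W L : Submodule (ZMod 2) V)
    (T : Set (V →ₗ[ZMod 2] V)) (hT : T.Finite)
    (hinv : ∀ f ∈ T, ∀ x, f (f x) = x)
    (hcomm : ∀ f ∈ T, ∀ g ∈ T, ∀ x, f (g x) = g (f x))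
    (hW : ∀ f ∈ T, ∀ x ∈ W, f x ∈ W) (hL : ∀ f ∈ T, ∀ x ∈ L, f x ∈ L)
    (hne : ¬ W ≤ L) : ∃ v ∈ W, v ∉ L ∧ ∀ f ∈ T, f v + v ∈ L := by
  induction T, hT using Set.Finite.induction_on with
  | empty =>
    obtain ⟨v, hv, hv'⟩ := SetLike.not_le_iff_exists.1 hne
    exact ⟨v, hv, hv', by simp⟩
  | @insert f T hf hT ih =>
    obtain ⟨v, hvW, hvL, hv⟩ := ih (fun g hg => hinv g (Or.inr hg))
      (fun g hg g' hg' => hcomm g (Or.inr hg) g' (Or.inr hg'))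
      (fun g hg => hW g (Or.inr hg)) (fun g hg => hL g (Or.inr hg))
    have hfm : f ∈ insert f T := Or.inl rfl
    by_cases h : f v + v ∈ L
    · refine ⟨v, hvW, hvL, ?_⟩
      rintro g (rfl | hg)
      · exact h
      · exact hv g hg
    · refine ⟨f v + v, W.add_mem (hW f hfm v hvW) hvW, h, ?_⟩
      rintro g (rfl | hg)
      · rw [map_add, hinv g hfm, add_comm (g v) v, zmodTwo_add_self]
        exact L.zero_mem
      · have h1 := hv g hg
        have h2 := L.add_mem (hL f hfm _ h1) h1
        rw [map_add, hcomm f hfm g (Or.inr hg)] at h2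
        rw [map_add]
        convert h2 using 1
        abel

lemma exists_lagrangian [FiniteDimensional (ZMod 2) V] (B : LinearMap.BilinForm (ZMod 2) V)
    (halt : B.IsAlt) (T : Set (V →ₗ[ZMod 2] V)) (hT : T.Finite)
    (hB : ∀ f ∈ T, ∀ x y, B (f x) (f y) = B x y)
    (hinv : ∀ f ∈ T, ∀ x, f (f x) = x)
    (hcomm : ∀ f ∈ T, ∀ g ∈ T, ∀ x, f (g x) = g (f x)) :
    ∃ L : Submodule (ZMod 2) V, (∀ f ∈ T, ∀ x ∈ L, f x ∈ L) ∧ B.orthogonal L = L := by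
  let Q : Set (Submodule (ZMod 2) V) :=
    {L | (∀ f ∈ T, ∀ x ∈ L, f x ∈ L) ∧ ∀ x ∈ L, ∀ y ∈ L, B x y = 0}
  have hQ : Q.Nonempty := by
    refine ⟨⊥, ?_, ?_⟩
    · intro f _ x hx
      rw [Submodule.mem_bot] at hx
      simp [hx]
    · intro x hx y _
      rw [Submodule.mem_bot] at hx
      simp [hx]
  obtain ⟨L, ⟨hL1, hL2⟩, hmax⟩ := WellFounded.has_min
    (wellFounded_gt (α := Submodule (ZMod 2) V)) Q hQ
  refine ⟨L, hL1, le_antisymm ?_ ?_⟩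
  · by_contra hne
    obtain ⟨v, hvW, hvL, hv⟩ := exists_fixed_mod (B.orthogonal L) L T hT hinv hcomm
      (by
        intro f hf x hx y hy
        have := hx (f y) (hL1 f hf y hy)
        have h3 := hB f hf (f y) x
        rw [hinv f hf] at h3
        exact h3.trans this) hL1 hne
    have hvW' : ∀ x ∈ L, B x v = 0 := hvW
    have hvW2 : ∀ x ∈ L, B v x = 0 := fun x hx => halt.isRefl _ _ (hvW' x hx)
    refine hmax (L ⊔ Submodule.span (ZMod 2) {v}) ⟨?_, ?_⟩ ?_
    · intro f hf x hx
      obtain ⟨a, ha, b, hb, rfl⟩ := Submodule.mem_sup.1 hx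
      obtain ⟨c, rfl⟩ := Submodule.mem_span_singleton.1 hb
      have : f (a + c • v) = (f a + c • (f v + v)) + c • v := by
        have := zmodTwo_add_self (c • v)
        rw [map_add, map_smul, smul_add, add_assoc, add_assoc, this, add_zero]
      rw [this]
      exact Submodule.add_mem_sup (L.add_mem (hL1 f hf a ha) (L.smul_mem c (hv f hf)))
        (Submodule.smul_mem _ _ (Submodule.mem_span_singleton_self v))
    · intro x hx y hy
      obtain ⟨a, ha, b, hb, rfl⟩ := Submodule.mem_sup.1 hx
      obtain ⟨c, rfl⟩ := Submodule.mem_span_singleton.1 hb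
      obtain ⟨a', ha', b, hb', rfl⟩ := Submodule.mem_sup.1 hy
      obtain ⟨c', rfl⟩ := Submodule.mem_span_singleton.1 hb'
      simp [hL2 a ha a' ha', hvW' a ha, hvW2 a' ha', halt v]
    · refine lt_of_le_of_ne le_sup_left ?_
      intro h
      apply hvL
      rw [h]
      exact Submodule.mem_sup_right (Submodule.mem_span_singleton_self v)
  · intro x hx y hy
    exact hL2 y hy x hx

end helpers

/-- The bilinear form of `Pm n`. -/
noncomputable def PmForm (n : ℕ) : LinearMap.BilinForm (ZMod 2) (Fin n ⊕ Fin n → ZMod 2) :=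
  Matrix.toBilin' (Pm n)

lemma Pm_mul_self (n : ℕ) : Pm n * Pm n = 1 := by
  simp [Pm, Matrix.fromBlocks_multiply]

lemma PmForm_apply (n : ℕ) (x y : Fin n ⊕ Fin n → ZMod 2) :
    PmForm n x y = x ⬝ᵥ (Pm n *ᵥ y) := Matrix.toBilin'_apply' _ _ _

lemma PmForm_alt (n : ℕ) : (PmForm n).IsAlt := by
  intro x
  rw [PmForm_apply]
  simp only [Pm, dotProduct, Matrix.fromBlocks_mulVec, Fintype.sum_sum_type]
  simp only [Sum.elim_inl, Sum.elim_inr, zero_mulVec, one_mulVec, zero_add, add_zero,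
    Function.comp_apply]
  rw [← Finset.sum_add_distrib]
  refine Finset.sum_eq_zero fun i _ => ?_
  rw [mul_comm (x (Sum.inr i))]
  exact zmodTwo_add_self _

lemma PmForm_nondeg (n : ℕ) : (PmForm n).Nondegenerate := by
  refine LinearMap.BilinForm.nondegenerate_toBilin'_of_det_ne_zero' _ ?_
  have h := congrArg Matrix.det (Pm_mul_self n)
  rw [Matrix.det_mul, Matrix.det_one] at h
  intro h0
  simp [h0] at h

lemma PmForm_symm (n : ℕ) (x y : Fin n ⊕ Fin n → ZMod 2) : PmForm n x y = PmForm n y x := by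
  have h := (PmForm_alt n).neg_eq x y
  rw [← h]
  exact eq_neg_of_add_eq_zero_left (zmodTwo_add_self _)

/-- Lagrangian vectors extend to a symplectic basis. -/
lemma exists_symplectic_basis (n : ℕ) (L : Submodule (ZMod 2) (Fin n ⊕ Fin n → ZMod 2))
    (hL : (PmForm n).orthogonal L = L) :
    ∃ e f : Fin n → (Fin n ⊕ Fin n → ZMod 2), (∀ i, e i ∈ L) ∧
      (∀ i j, PmForm n (e i) (f j) = if i = j then 1 else 0) ∧
      ∀ i j, PmForm n (f i) (f j) = 0 := by
  have hiso : ∀ x ∈ L, ∀ y ∈ L, PmForm n x y = 0 := by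
    intro x hx y hy
    rw [← hL] at hy
    exact hy x hx
  have hdim : Module.finrank (ZMod 2) L = n := by
    have h := LinearMap.BilinForm.finrank_orthogonal (PmForm_nondeg n) L
    have h2 := Submodule.finrank_le L
    rw [hL] at h
    simp only [Module.finrank_fintype_fun_eq_card, Fintype.card_sum, Fintype.card_fin] at h h2
    omega
  let b := Module.finBasisOfFinrankEq (ZMod 2) L hdim
  have hf : ∀ j, ∃ f, ∀ i, PmForm n (b i : Fin n ⊕ Fin n → ZMod 2) f = if i = j then 1 else 0 := by
    intro j
    obtain ⟨φ, hφ⟩ := LinearMap.exists_extend (b.coord j)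
    refine ⟨Pm n *ᵥ fun k => φ (Pi.single k 1), fun i => ?_⟩
    rw [PmForm_apply, Matrix.mulVec_mulVec, Pm_mul_self, one_mulVec]
    have h1 : φ (b i : Fin n ⊕ Fin n → ZMod 2) = if i = j then 1 else 0 := by
      have := LinearMap.congr_fun hφ (b i)
      simp only [LinearMap.comp_apply, Submodule.subtype_apply] at this
      rw [this, Module.Basis.coord_apply, Module.Basis.repr_self, Finsupp.single_apply]
    rw [← h1, LinearMap.pi_apply_eq_sum_univ φ]
    simp only [dotProduct, smul_eq_mul]
    refine Finset.sum_congr rfl fun k _ => ?_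
    congr 2
    ext l
    simp [Pi.single_apply, eq_comm]
  choose f hf using hf
  have hee : ∀ i j, PmForm n (b i : Fin n ⊕ Fin n → ZMod 2) (b j) = 0 :=
    fun i j => hiso _ (b i).2 _ (b j).2
  refine ⟨fun i => b i, fun i => f i + ∑ j, (if j < i then PmForm n (f i) (f j) else 0) •
    (b j : Fin n ⊕ Fin n → ZMod 2), fun i => (b i).2, ?_, ?_⟩
  · intro i j
    simp only [map_add, map_sum, map_smul, hf, hee, smul_zero, Finset.sum_const_zero, add_zero]
  · intro i k
    have hf' : ∀ i j, PmForm n (f j) (b i : Fin n ⊕ Fin n → ZMod 2) = if i = j then 1 else 0 :=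
      fun i j => by rw [PmForm_symm, hf]
    simp only [map_add, map_sum, map_smul, LinearMap.add_apply, LinearMap.sum_apply,
      LinearMap.smul_apply, hf, hf', hee, smul_eq_mul, mul_ite, mul_one, mul_zero,
      Finset.sum_ite_eq', Finset.mem_univ, if_true, Finset.sum_const_zero, add_zero]
    have h2 := zmodTwo_add_self (PmForm n (f i) (f k))
    have h3 := PmForm_symm n (f k) (f i)
    rcases lt_trichotomy i k with h | h | h
    · simp [h, h.not_gt, h3, h2]
    · subst h
      simp [PmForm_alt n (f i)]
    · simp [h, h.not_gt, h2]

/-- A commuting family of `2n × 2n` symplectic involutions over `Z_2` can be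
simultaneously symplectically conjugated into block upper-triangular form
`[[A, E],[0, Aᵀ]]`. -/
theorem commuting_symplectic_involutions_normal_form (n : ℕ) (hn : 1 ≤ n)
    (S : Set (Matrix (Fin n ⊕ Fin n) (Fin n ⊕ Fin n) (ZMod 2)))
    (hsymp : ∀ C ∈ S, Cᵀ * Pm n * C = Pm n)
    (hinv : ∀ C ∈ S, C * C = 1)
    (hcomm : ∀ C ∈ S, ∀ C' ∈ S, C * C' = C' * C) :
    ∃ M : Matrix (Fin n ⊕ Fin n) (Fin n ⊕ Fin n) (ZMod 2),
      Mᵀ * Pm n * M = Pm n ∧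
      ∀ C ∈ S, ∃ A E : Matrix (Fin n) (Fin n) (ZMod 2),
        M * C * M⁻¹ = Matrix.fromBlocks A E 0 Aᵀ := by
  classical
  obtain ⟨L, hLinv, hL⟩ := exists_lagrangian (PmForm n) (PmForm_alt n)
    ((fun C => Matrix.mulVecLin C) '' S) (Set.toFinite S |>.image _)
    (by
      rintro _ ⟨C, hC, rfl⟩ x y
      simp only [Matrix.mulVecLin_apply, PmForm_apply]
      conv_rhs => rw [← hsymp C hC, ← Matrix.mulVec_mulVec, ← Matrix.mulVec_mulVec,
        Matrix.dotProduct_mulVec x, Matrix.vecMul_transpose])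
    (by
      rintro _ ⟨C, hC, rfl⟩ x
      simp only [Matrix.mulVecLin_apply, Matrix.mulVec_mulVec, hinv C hC, one_mulVec])
    (by
      rintro _ ⟨C, hC, rfl⟩ _ ⟨D, hD, rfl⟩ x
      simp only [Matrix.mulVecLin_apply, Matrix.mulVec_mulVec, hcomm C hC D hD])
  obtain ⟨e, f, he, hef, hff⟩ := exists_symplectic_basis n L hL
  have hiso : ∀ x ∈ L, ∀ y ∈ L, PmForm n x y = 0 := by
    intro x hx y hy
    rw [← hL] at hy
    exact hy x hx
  -- the symplectic matrix whose columns are the adapted basis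
  let N : Matrix (Fin n ⊕ Fin n) (Fin n ⊕ Fin n) (ZMod 2) := Matrix.of fun k i => Sum.elim e f i k
  have hentry : ∀ (X : Matrix (Fin n ⊕ Fin n) (Fin n ⊕ Fin n) (ZMod 2)) i j,
      (Nᵀ * Pm n * (X * N)) i j = PmForm n (Sum.elim e f i) (X *ᵥ Sum.elim e f j) := by
    intro X i j
    have h : (Nᵀ * (Pm n * (X * N))) i j
        = Sum.elim e f i ⬝ᵥ (fun k => (Pm n * (X * N)) k j) := rfl
    have h' : (fun k => (Pm n * (X * N)) k j) = Pm n *ᵥ (X *ᵥ Sum.elim e f j) := rfl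
    rw [PmForm_apply, Matrix.mul_assoc, h, h']
  have hN : Nᵀ * Pm n * N = Pm n := by
    ext i j
    have h := hentry 1 i j
    rw [Matrix.one_mul, one_mulVec] at h
    rw [h]
    rcases i with i | i <;> rcases j with j | j
    · simp [Pm, hiso _ (he i) _ (he j)]
    · simp [Pm, hef, Matrix.one_apply]
    · simp [Pm, PmForm_symm n (f i), hef, Matrix.one_apply, eq_comm]
    · simp [Pm, hff]
  have hNinv : (Pm n * Nᵀ * Pm n) * N = 1 := by
    rw [Matrix.mul_assoc, Matrix.mul_assoc, ← Matrix.mul_assoc Nᵀ, hN, Pm_mul_self]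
  have hNN : N * N⁻¹ = 1 := Matrix.mul_nonsing_inv _ (Matrix.isUnit_det_of_left_inverse hNinv)
  have hN' : N⁻¹ * N = 1 := Matrix.nonsing_inv_mul _ (Matrix.isUnit_det_of_left_inverse hNinv)
  have hNi : N⁻¹ = Pm n * Nᵀ * Pm n := Matrix.inv_eq_left_inv hNinv
  refine ⟨N⁻¹, ?_, ?_⟩
  · calc (N⁻¹)ᵀ * Pm n * N⁻¹ = (N⁻¹)ᵀ * (Nᵀ * Pm n * N) * N⁻¹ := by rw [hN]
      _ = (N * N⁻¹)ᵀ * Pm n * (N * N⁻¹) := by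
        rw [Matrix.transpose_mul]; simp only [Matrix.mul_assoc]
      _ = Pm n := by rw [hNN]; simp
  · intro C hC
    rw [Matrix.nonsing_inv_nonsing_inv _ (Matrix.isUnit_det_of_left_inverse hNinv)]
    set D := N⁻¹ * C * N with hD
    have hDsymp : Dᵀ * Pm n * D = Pm n := by
      have h1 : (N⁻¹)ᵀ * Pm n * N⁻¹ = Pm n := by
        calc (N⁻¹)ᵀ * Pm n * N⁻¹ = (N⁻¹)ᵀ * (Nᵀ * Pm n * N) * N⁻¹ := by rw [hN]
          _ = (N * N⁻¹)ᵀ * Pm n * (N * N⁻¹) := by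
            rw [Matrix.transpose_mul]; simp only [Matrix.mul_assoc]
          _ = Pm n := by rw [hNN]; simp
      calc Dᵀ * Pm n * D = Nᵀ * (Cᵀ * ((N⁻¹)ᵀ * Pm n * N⁻¹) * C) * N := by
            rw [hD, Matrix.transpose_mul, Matrix.transpose_mul]; simp only [Matrix.mul_assoc]
        _ = Pm n := by rw [h1, hsymp C hC, hN]
    have hDD : D * D = 1 := by
      calc D * D = N⁻¹ * C * (N * N⁻¹) * C * N := by rw [hD]; simp only [Matrix.mul_assoc]
        _ = N⁻¹ * (C * C) * N := by rw [hNN, Matrix.mul_one]; simp only [Matrix.mul_assoc]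
        _ = 1 := by rw [hinv C hC, Matrix.mul_one, hN']
    have hPD : Pm n * D = Nᵀ * Pm n * (C * N) := by
      rw [hD, hNi]
      simp only [← Matrix.mul_assoc, Pm_mul_self, Matrix.one_mul]
    have h21 : D.toBlocks₂₁ = 0 := by
      ext i j
      have h0 : PmForm n (e i) (C *ᵥ e j) = 0 :=
        hiso _ (he i) _ (hLinv _ ⟨C, hC, rfl⟩ _ (he j))
      have h := hentry C (Sum.inl i) (Sum.inl j)
      rw [← hPD, Sum.elim_inl, Sum.elim_inl,
        h0, ← Matrix.fromBlocks_toBlocks D, Pm,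
        Matrix.fromBlocks_multiply] at h
      simpa using h
    obtain ⟨A, E, F, hDb⟩ : ∃ A E F, D = Matrix.fromBlocks A E 0 F :=
      ⟨_, _, _, by rw [← h21, Matrix.fromBlocks_toBlocks]⟩
    refine ⟨A, E, ?_⟩
    rw [hDb, Pm, Matrix.fromBlocks_transpose, Matrix.fromBlocks_multiply,
      Matrix.fromBlocks_multiply] at hDsymp
    rw [hDb, Matrix.fromBlocks_multiply, ← Matrix.fromBlocks_one] at hDD
    obtain ⟨-, h1, -, -⟩ := Matrix.fromBlocks_inj.1 hDsymp
    obtain ⟨h2, -, -, -⟩ := Matrix.fromBlocks_inj.1 hDD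
    simp only [Matrix.mul_zero, Matrix.transpose_zero, Matrix.zero_mul, Matrix.mul_one, zero_add,
      add_zero] at h1 h2
    have h3 : Aᵀ * Aᵀ = 1 := by rw [← Matrix.transpose_mul, h2, Matrix.transpose_one]
    have h4 : F = Aᵀ := by
      calc F = Aᵀ * Aᵀ * F := by rw [h3, Matrix.one_mul]
        _ = Aᵀ := by rw [Matrix.mul_assoc, h1, Matrix.mul_one]
    rw [hDb, h4]
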